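/- Let c ≥ 1, let S ⊆ Σ^c be a finite set of n ≥ 1 keys, and let q ∈ Σ^c be a query key. Then there exists a linear order ≺ on the position-characters Fin c × Σ in which the c position-characters (i, q_i) of q are the ≺-smallest elements, and such that every group G_α = {x ∈ S : max_≺(x) = α} satisfies |G_α| ≤ 2·n^{1 − 1/c}. -/

import Mathlib

open Finset

lemma exists_light {c : ℕ} (hc : 1 ≤ c) {A : Type} [DecidableEq A]
    (q : Fin c → A) (n : ℕ) (T : Finset (Fin c → A)) (hTn : T.card ≤ n)
    (hB : 2 * (n : ℝ) ^ ((1 : ℝ) - 1 / (c : ℝ)) < T.card) :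
    ∃ (i : Fin c) (a : A), a ≠ q i ∧ (∃ x ∈ T, x i = a) ∧
      ((T.filter (fun x => x i = a)).card : ℝ) ≤ 2 * (n : ℝ) ^ ((1 : ℝ) - 1 / (c : ℝ)) := by
  by_contra! hcon
  have hc' : (1 : ℝ) ≤ c := by exact_mod_cast hc
  have hexp : (0 : ℝ) ≤ 1 - 1 / (c : ℝ) := by
    have : 1 / (c : ℝ) ≤ 1 := by rw [div_le_one (by linarith)]; exact hc'
    linarith
  have hm0 : (0 : ℝ) < T.card := lt_of_le_of_lt (by positivity) hB
  have hTne : T.Nonempty := by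
    rw [← Finset.card_pos]; exact_mod_cast hm0
  set B := 2 * (n : ℝ) ^ ((1 : ℝ) - 1 / (c : ℝ)) with hBdef
  set m : ℝ := (T.card : ℝ) with hm
  set s : ℝ := m ^ ((1 : ℝ) - 1 / (c : ℝ)) with hs
  set t : ℝ := m ^ (1 / (c : ℝ)) with ht
  have hsB : 2 * s ≤ B := by
    have : s ≤ (n : ℝ) ^ ((1 : ℝ) - 1 / (c : ℝ)) :=
      Real.rpow_le_rpow hm0.le (Nat.cast_le.2 hTn) hexp
    linarith
  have hs0 : 0 < s := Real.rpow_pos_of_pos hm0 _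
  have hst : s * t = m := by
    rw [hs, ht, ← Real.rpow_add hm0]; simp
  have htc : t ^ c = m := by
    rw [ht, one_div]
    exact Real.rpow_inv_natCast_pow hm0.le (by omega)
  have ht2 : 2 < t := by
    by_contra! h
    nlinarith
  have hd : ∀ i : Fin c, ((T.image (fun x => x i)).card : ℝ) < t := by
    intro i
    set I := T.image (fun x => x i) with hI
    have h1 : (I.card : ℝ) - 1 ≤ (I.erase (q i)).card := by
      have : I.card ≤ (I.erase (q i)).card + 1 := by
        have := Finset.pred_card_le_card_erase (s := I) (a := q i)
        omega
      have : (I.card : ℝ) ≤ (I.erase (q i)).card + 1 := by exact_mod_cast this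
      linarith
    have h2 : ((I.erase (q i)).card : ℝ) * B ≤ m := by
      have h3 : ∑ a ∈ I, (T.filter (fun x => x i = a)).card = T.card :=
        (Finset.card_eq_sum_card_image (fun x : Fin c → A => x i) T).symm
      have h4 : ∑ a ∈ I.erase (q i), ((T.filter (fun x => x i = a)).card : ℝ) ≤ m := by
        rw [hm, ← h3]
        push_cast
        exact Finset.sum_le_sum_of_subset_of_nonneg (Finset.erase_subset _ _)
          (fun _ _ _ => by positivity)
      have h5 : ∑ a ∈ I.erase (q i), B ≤
          ∑ a ∈ I.erase (q i), ((T.filter (fun x => x i = a)).card : ℝ) := by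
        apply Finset.sum_le_sum
        intro a ha
        rw [Finset.mem_erase, hI, Finset.mem_image] at ha
        exact (hcon i a ha.1 ha.2).le
      rw [Finset.sum_const, nsmul_eq_mul] at h5
      linarith
    have h6 : ((I.erase (q i)).card : ℝ) * (2 * s) ≤ s * t := by
      rw [hst]
      exact le_trans (mul_le_mul_of_nonneg_left hsB (by positivity)) h2
    have h7 : ((I.erase (q i)).card : ℝ) * 2 ≤ t := by
      by_contra! h
      nlinarith
    linarith
  have hprod : (T.card : ℝ) ≤ ∏ i : Fin c, ((T.image (fun x => x i)).card : ℝ) := by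
    have : T.card ≤ (Fintype.piFinset (fun i => T.image (fun x => x i))).card := by
      apply Finset.card_le_card
      intro x hx
      rw [Fintype.mem_piFinset]
      intro i
      exact Finset.mem_image_of_mem (fun x : Fin c → A => x i) hx
    rw [Fintype.card_piFinset] at this
    exact_mod_cast this
  have : ∏ i : Fin c, ((T.image (fun x => x i)).card : ℝ) < ∏ i : Fin c, t := by
    apply Finset.prod_lt_prod_of_nonempty
    · intro i _
      exact_mod_cast Finset.card_pos.2 (hTne.image _)
    · intro i _; exact hd i
    · exact ⟨⟨0, by omega⟩, Finset.mem_univ _⟩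
  rw [Finset.prod_const, Finset.card_univ, Fintype.card_fin, htc] at this
  linarith

lemma base_order {c : ℕ} {A : Type} [Fintype A] [DecidableEq A] (q : Fin c → A) :
    ∃ π : Fin c × A → ℕ, Function.Injective π ∧
      (∀ (i : Fin c) (β : Fin c × A), (∀ i' : Fin c, β ≠ (i', q i')) →
        π (i, q i) < π β) := by
  let e := Fintype.equivFin (Fin c × A)
  refine ⟨fun p => if p.2 = q p.1 then (e p : ℕ) else e p + Fintype.card (Fin c × A), ?_, ?_⟩
  · intro x y h
    have hx := (e x).2
    have hy := (e y).2
    apply e.injective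
    apply Fin.ext
    dsimp only at h
    split_ifs at h <;> omega
  · intro i β h
    have hβ : β.2 ≠ q β.1 := fun h' => h β.1 (Prod.ext rfl h')
    have := (e (i, q i)).2
    simp only [hβ, if_true, if_false]
    omega

lemma order_aux (c : ℕ) (hc : 1 ≤ c) (A : Type) [Fintype A] [DecidableEq A]
    (q : Fin c → A) (n : ℕ) (k : ℕ) : ∀ T : Finset (Fin c → A), T.card ≤ n → T.card ≤ k →
    ∃ π : Fin c × A → ℕ, Function.Injective π ∧
      (∀ (i : Fin c) (β : Fin c × A), (∀ i' : Fin c, β ≠ (i', q i')) →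
        π (i, q i) < π β) ∧
      ∀ α : Fin c × A,
        ((T.filter (fun x => (∃ i, (i, x i) = α) ∧ ∀ i, π (i, x i) ≤ π α)).card : ℝ) ≤
          2 * (n : ℝ) ^ ((1 : ℝ) - 1 / (c : ℝ)) := by
  induction k with
  | zero =>
    intro T _ hT
    obtain ⟨π, h1, h2⟩ := base_order q
    have : T = ∅ := Finset.card_eq_zero.1 (by omega)
    subst this
    refine ⟨π, h1, h2, fun α => ?_⟩
    simp only [Finset.filter_empty, Finset.card_empty, Nat.cast_zero]
    positivity
  | succ k ih =>
    intro T hTn hTk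
    by_cases hB : (T.card : ℝ) ≤ 2 * (n : ℝ) ^ ((1 : ℝ) - 1 / (c : ℝ))
    · obtain ⟨π, h1, h2⟩ := base_order q
      refine ⟨π, h1, h2, fun α => le_trans ?_ hB⟩
      exact_mod_cast Finset.card_filter_le _ _
    · obtain ⟨i₀, a, haq, ⟨x₀, hx₀, hx₀a⟩, hcard⟩ :=
        exists_light hc q n T hTn (not_le.1 hB)
      have hlt : (T.filter (fun x => x i₀ ≠ a)).card < T.card :=
        Finset.card_lt_card (Finset.filter_ssubset.2 ⟨x₀, hx₀, by simpa using hx₀a⟩)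
      obtain ⟨π, h1, h2, h3⟩ := ih (T.filter (fun x => x i₀ ≠ a)) (by omega) (by omega)
      set M := Finset.univ.sup π + 1 with hM
      have hlM : ∀ p, π p < M := fun p =>
        Nat.lt_succ_of_le (Finset.le_sup (Finset.mem_univ p))
      refine ⟨Function.update π (i₀, a) M, ?_, ?_, ?_⟩
      · intro x y h
        have hx := hlM x
        have hy := hlM y
        simp only [Function.update_apply] at h
        split_ifs at h with h4 h5 h5
        · rw [h4, h5]
        · omega
        · omega
        · exact h1 h
      · intro i β hβ
        have hne : (i, q i) ≠ (i₀, a) := by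
          intro h
          rw [Prod.mk.injEq] at h
          obtain ⟨rfl, h⟩ := h
          exact haq h.symm
        rw [Function.update_of_ne hne, Function.update_apply]
        split_ifs
        · exact hlM _
        · exact h2 i β hβ
      · intro α
        by_cases hα : α = (i₀, a)
        · refine le_trans ?_ hcard
          norm_cast
          apply Finset.card_le_card
          intro x hx
          rw [Finset.mem_filter] at hx ⊢
          obtain ⟨hxT, ⟨i, hi⟩, -⟩ := hx
          rw [hα, Prod.mk.injEq] at hi
          obtain ⟨rfl, h⟩ := hi
          exact ⟨hxT, h⟩
        · refine le_trans ?_ (h3 α)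
          norm_cast
          apply Finset.card_le_card
          intro x hx
          rw [Finset.mem_filter] at hx
          obtain ⟨hxT, hi, hle⟩ := hx
          rw [Function.update_of_ne hα] at hle
          have hne : ∀ i, (i, x i) ≠ (i₀, a) := by
            intro i h
            have h4 := hle i
            rw [h, Function.update_self] at h4
            have := hlM α
            omega
          rw [Finset.mem_filter, Finset.mem_filter]
          refine ⟨⟨hxT, fun h => hne i₀ (by rw [h])⟩, hi, fun i => ?_⟩
          have h4 := hle i
          rwa [Function.update_of_ne (hne i)] at h4


/-- Lemma 4 of the paper: there is a linear order on position-characters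
(represented by an injective ranking `π : Fin c × A → ℕ`) in which the
position-characters of the query key `q` come first, and such that every group
`G_α = {x ∈ S : max_≺(x) = α}` has size at most `2·n^{1-1/c}`. -/
theorem exists_query_first_order_with_small_groups
    (c : ℕ) (hc : 1 ≤ c) (A : Type) [Fintype A] [DecidableEq A]
    (S : Finset (Fin c → A)) (q : Fin c → A) (hS : 1 ≤ S.card) :
    ∃ π : Fin c × A → ℕ, Function.Injective π ∧
      (∀ (i : Fin c) (β : Fin c × A), (∀ i' : Fin c, β ≠ (i', q i')) →
        π (i, q i) < π β) ∧
      ∀ α : Fin c × A,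
        ((S.filter (fun x => (∃ i, (i, x i) = α) ∧ ∀ i, π (i, x i) ≤ π α)).card : ℝ) ≤
          2 * (S.card : ℝ) ^ ((1 : ℝ) - 1 / (c : ℝ)) := by
  exact order_aux c hc A q S.card S.card S le_rfl le_rfl
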